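/- With respect to the tridiagonal bracket {·,·}_c, the pKdV multi-sums satisfy the symmetric relation {Ψ^{1,p}_r, Ψ^{1,p−1}_s}_c + {Ψ^{1,p−1}_r, Ψ^{1,p}_s}_c = 0 for all 0 ≤ r, s ≤ ⌊(p+1)/2⌋. -/

import Mathlib

/-- The pKdV multi-sum
`Ψ^{a,b}_r = (Σ_{a ≤ i₁, i_j+1 < i_{j+1}, i_r ≤ b} Π_j f_{i_j}) · Π_{i=a}^{b+1} c_i`,
where `f_i = 1/(c_i c_{i+1})` and the sum ranges over `r` indices in `[a,b]`, pairwise at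
distance `≥ 2`.  For `r = 0` this is `Π_{i=a}^{b+1} c_i`, and `Ψ = 0` for `r < 0`. -/
noncomputable def Psi (c : ℤ → ℝ) (a b : ℤ) (r : ℤ) : ℝ :=
  if 0 ≤ r then
    (∑ s ∈ ((Finset.Icc a b).powersetCard r.toNat).filter
        (fun s => ∀ i ∈ s, ∀ j ∈ s, i < j → i + 2 ≤ j),
      ∏ i ∈ s, (c i * c (i + 1))⁻¹) * ∏ i ∈ Finset.Icc a (b + 1), c i
  else 0

/-- The partial derivative `∂g/∂c_i` of a function of the variables `c : ℤ → ℝ`. -/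
noncomputable def pdC (g : (ℤ → ℝ) → ℝ) (i : ℤ) (c : ℤ → ℝ) : ℝ :=
  deriv (fun t => g (Function.update c i t)) (c i)

/-- The tridiagonal constant Poisson bracket on the variables `c_1, …, c_{2n}`:
`{g,h}_c = Σ_{i=1}^{2n−1} (∂g/∂c_i ∂h/∂c_{i+1} − ∂g/∂c_{i+1} ∂h/∂c_i)`. -/
noncomputable def cBracket (n : ℕ) (g h : (ℤ → ℝ) → ℝ) (c : ℤ → ℝ) : ℝ :=
  ∑ i ∈ Finset.Icc (1 : ℤ) (2 * n - 1),
    (pdC g i c * pdC h (i + 1) c - pdC g (i + 1) c * pdC h i c)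

/-- Continuant-type recursion for the multi-sums, `m` variables. -/
noncomputable def KK (c : ℤ → ℝ) : ℕ → ℤ → ℝ
  | 0, r => if r = 0 then 1 else 0
  | 1, r => if r = 0 then c 1 else 0
  | (m + 2), r => c ((m : ℤ) + 2) * KK c (m + 1) r + KK c m (r - 1)

/-- Formal gradient of `KK`. -/
noncomputable def GG (c : ℤ → ℝ) : ℕ → ℤ → ℤ → ℝ
  | 0, _ => 0
  | 1, r => (if r = 0 then (1 : ℝ) else 0) • Pi.single 1 1
  | (m + 2), r => KK c (m + 1) r • Pi.single ((m : ℤ) + 2) 1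
      + c ((m : ℤ) + 2) • GG c (m + 1) r + GG c m (r - 1)

noncomputable def Br (N : ℤ) (u v : ℤ → ℝ) : ℝ :=
  ∑ i ∈ Finset.Icc (1 : ℤ) N, (u i * v (i + 1) - u (i + 1) * v i)

lemma Br_add_left (N : ℤ) (u u' v : ℤ → ℝ) : Br N (u + u') v = Br N u v + Br N u' v := by
  unfold Br
  rw [← Finset.sum_add_distrib]
  refine Finset.sum_congr rfl fun i _ => ?_
  simp only [Pi.add_apply]; ring

lemma Br_smul_left (N : ℤ) (a : ℝ) (u v : ℤ → ℝ) : Br N (a • u) v = a * Br N u v := by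
  unfold Br
  rw [Finset.mul_sum]
  refine Finset.sum_congr rfl fun i _ => ?_
  simp only [Pi.smul_apply, smul_eq_mul]; ring

lemma Br_swap (N : ℤ) (u v : ℤ → ℝ) : Br N u v = - Br N v u := by
  unfold Br
  rw [← Finset.sum_neg_distrib]
  refine Finset.sum_congr rfl fun i _ => ?_
  ring

lemma Br_self (N : ℤ) (u : ℤ → ℝ) : Br N u u = 0 := by
  have := Br_swap N u u
  linarith

lemma Br_add_right (N : ℤ) (u v v' : ℤ → ℝ) : Br N u (v + v') = Br N u v + Br N u v' := by
  rw [Br_swap, Br_add_left, Br_swap N u v, Br_swap N u v']; ring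

lemma Br_smul_right (N : ℤ) (a : ℝ) (u v : ℤ → ℝ) : Br N u (a • v) = a * Br N u v := by
  rw [Br_swap, Br_smul_left, Br_swap N u v]; ring

lemma Br_zero_left (N : ℤ) (v : ℤ → ℝ) : Br N 0 v = 0 := by
  simp [Br]

lemma Br_zero_right (N : ℤ) (v : ℤ → ℝ) : Br N v 0 = 0 := by
  simp [Br]

lemma GG_supp (c : ℤ → ℝ) (m : ℕ) : ∀ (r i : ℤ), (m : ℤ) < i → GG c m r i = 0 := by
  induction m using Nat.strong_induction_on with
  | _ m ih =>
    match m, ih with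
    | 0, _ => intro r i _; simp [GG]
    | 1, _ =>
      intro r i hi
      have : i ≠ 1 := by push_cast at hi; omega
      simp [GG, this]
    | (m + 2), ih =>
      intro r i hi
      push_cast at hi
      have h : i ≠ (m : ℤ) + 2 := by omega
      simp [GG, h, ih (m + 1) (by omega) r i (by push_cast; omega),
        ih m (by omega) (r - 1) i (by omega)]

lemma GG_top (c : ℤ → ℝ) (m : ℕ) (r : ℤ) : GG c (m + 1) r ((m : ℤ) + 1) = KK c m r := by
  match m with
  | 0 => simp [GG, KK]
  | (m + 1) =>
    have h1 : ((m + 1 : ℕ) : ℤ) + 1 = (m : ℤ) + 2 := by push_cast; ring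
    rw [h1]
    simp [GG, GG_supp c (m + 1) r (m + 2) (by push_cast; omega),
      GG_supp c m (r - 1) (m + 2) (by omega)]

lemma Br_single (N m : ℤ) (hm : 1 ≤ m) (hN : m ≤ N) (v : ℤ → ℝ) (hv : v (m + 2) = 0) :
    Br N (Pi.single (m + 1) 1) v = - v m := by
  unfold Br
  rw [Finset.sum_eq_single m]
  · simp
  · intro i hi hne
    simp only [Finset.mem_Icc] at hi
    have h1 : i + 1 ≠ m + 1 := by omega
    by_cases h2 : i = m + 1
    · subst h2
      have : m + 1 + 1 = m + 2 := by ring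
      simp [this, hv]
    · simp [h2, hne]
  · intro h
    simp only [Finset.mem_Icc] at h
    omega

lemma main_ind (c : ℤ → ℝ) (N : ℤ) (m : ℕ) : (m : ℤ) ≤ N →
    (∀ r s, Br N (GG c m r) (GG c m s) = 0) ∧
    (∀ r s, Br N (GG c (m + 1) r) (GG c (m + 1) s) = 0) ∧
    (∀ r s, Br N (GG c (m + 1) r) (GG c m s) + Br N (GG c m r) (GG c (m + 1) s) = 0) ∧
    (∀ r s, KK c m r * KK c (m + 1) s - KK c (m + 1) r * KK c m s =
      Br N (GG c (m + 1) (r - 1)) (GG c m s) - Br N (GG c (m + 1) r) (GG c m (s - 1))) := by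
  induction m with
  | zero =>
    intro _
    refine ⟨?_, ?_, ?_, ?_⟩
    · intro r s; simp [GG, Br_zero_left]
    · intro r s; simp only [GG, Br_smul_left, Br_smul_right, Br_self, mul_zero]
    · intro r s; simp [GG, Br_zero_left, Br_zero_right]
    · intro r s; simp only [GG, Br_zero_right, KK]; split_ifs <;> simp
  | succ m ih =>
    intro hN
    push_cast at hN
    obtain ⟨hA0, hA1, hS, hW⟩ := ih (by omega)
    have hd1 : ∀ s, Br N (Pi.single ((m : ℤ) + 2) 1) (GG c (m + 1) s) = - KK c m s := by
      intro s
      rw [← GG_top, ← Br_single N (m + 1) (by omega) hN _ (GG_supp c _ _ _ (by push_cast; omega))]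
      congr 2
    have hd0 : ∀ s, Br N (Pi.single ((m : ℤ) + 2) 1) (GG c m s) = 0 := by
      intro s
      have := Br_single N (m + 1) (by omega) hN _ (GG_supp c m s (m + 1 + 2) (by omega))
      rw [GG_supp c m s (m + 1) (by omega)] at this
      rw [show (m : ℤ) + 2 = m + 1 + 1 by ring, this]; simp
    have hd1' : ∀ s, Br N (GG c (m + 1) s) (Pi.single ((m : ℤ) + 2) 1) = KK c m s := by
      intro s; rw [Br_swap, hd1]; ring
    have hd0' : ∀ s, Br N (GG c m s) (Pi.single ((m : ℤ) + 2) 1) = 0 := by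
      intro s; rw [Br_swap, hd0]; ring
    have hB : ∀ r s, Br N (GG c (m + 2) r) (GG c (m + 1) s) =
        - KK c (m + 1) r * KK c m s + Br N (GG c m (r - 1)) (GG c (m + 1) s) := by
      intro r s
      simp only [GG, Br_add_left, Br_smul_left, hd1, hA1]; ring
    have hC : ∀ r s, Br N (GG c (m + 1) r) (GG c (m + 2) s) =
        KK c (m + 1) s * KK c m r + Br N (GG c (m + 1) r) (GG c m (s - 1)) := by
      intro r s
      simp only [GG, Br_add_right, Br_smul_right, hd1', hA1]; ring
    refine ⟨hA1, ?_, ?_, ?_⟩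
    · intro r s
      show Br N (GG c (m + 2) r) (GG c (m + 2) s) = 0
      simp only [GG, Br_add_right, Br_smul_right, Br_add_left, Br_smul_left, Br_self, hd1', hd0',
        hd1, hd0, hA1, hA0]
      linear_combination c ((m : ℤ) + 2) * hW r s + c ((m : ℤ) + 2) * hS (r - 1) s
    · intro r s
      show Br N (GG c (m + 2) r) (GG c (m + 1) s) + Br N (GG c (m + 1) r) (GG c (m + 2) s) = 0
      rw [hB, hC]
      linear_combination hW r s + hS (r - 1) s
    · intro r s
      show KK c (m + 1) r * KK c (m + 2) s - KK c (m + 2) r * KK c (m + 1) s =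
        Br N (GG c (m + 2) (r - 1)) (GG c (m + 1) s) - Br N (GG c (m + 2) r) (GG c (m + 1) (s - 1))
      rw [hB, hB]
      simp only [KK]
      linear_combination -hW (r - 1) s - hS (r - 1 - 1) s + hS (r - 1) (s - 1)

lemma KK_deriv (c : ℤ → ℝ) (i : ℤ) (m : ℕ) : ∀ r : ℤ,
    HasDerivAt (fun t => KK (Function.update c i t) m r) (GG c m r i) (c i) := by
  have hu : ∀ j, HasDerivAt (fun t => Function.update c i t j) ((Pi.single j 1 : ℤ → ℝ) i) (c i) := by
    intro j
    by_cases h : j = i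
    · subst h; simpa using hasDerivAt_id' (c j)
    · have h' : i ≠ j := fun e => h e.symm
      simpa [Function.update_apply, h, Pi.single_apply, h'] using hasDerivAt_const (c i) (c j)
  induction m using Nat.strong_induction_on with
  | _ m ih =>
    match m, ih with
    | 0, _ => intro r; simpa [GG, KK] using hasDerivAt_const (c i) _
    | 1, _ =>
      intro r
      by_cases hr : r = 0
      · simpa [GG, KK, hr] using hu 1
      · simpa [GG, KK, hr] using hasDerivAt_const (c i) (0 : ℝ)
    | (m + 2), ih =>
      intro r
      have := ((hu ((m : ℤ) + 2)).mul (ih (m + 1) (by omega) r)).add (ih m (by omega) (r - 1))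
      refine HasDerivAt.congr_deriv (f := fun t => KK (Function.update c i t) (m + 2) r) this ?_
      simp only [GG, Pi.add_apply, Pi.smul_apply, smul_eq_mul, Function.update_eq_self]; ring

/-- Sparse subsets. -/
noncomputable def Sp (b : ℤ) (k : ℕ) : Finset (Finset ℤ) :=
  ((Finset.Icc 1 b).powersetCard k).filter (fun s => ∀ i ∈ s, ∀ j ∈ s, i < j → i + 2 ≤ j)

lemma mem_Sp (b : ℤ) (k : ℕ) (s : Finset ℤ) : s ∈ Sp b k ↔
    (∀ i ∈ s, 1 ≤ i ∧ i ≤ b) ∧ s.card = k ∧ ∀ i ∈ s, ∀ j ∈ s, i < j → i + 2 ≤ j := by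
  simp [Sp, Finset.mem_powersetCard, Finset.subset_iff, and_assoc]

lemma Sp_zero (b : ℤ) : Sp b 0 = {∅} := by
  ext s
  rw [mem_Sp]
  simp only [Finset.card_eq_zero, Finset.mem_singleton]
  constructor
  · exact fun h => h.2.1
  · rintro rfl; simp

lemma Sp_empty (b : ℤ) (hb : b ≤ 0) (k : ℕ) (hk : k ≠ 0) : Sp b k = ∅ := by
  ext s
  rw [mem_Sp]
  simp only [Finset.notMem_empty, iff_false]
  rintro ⟨h1, h2, -⟩
  obtain ⟨i, hi⟩ := Finset.card_pos.mp (show 0 < s.card by omega)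
  have := h1 i hi
  omega

lemma Sp_succ (m : ℤ) (hm : 0 ≤ m) (k : ℕ) (f : ℤ → ℝ) :
    ∑ s ∈ Sp (m + 1) (k + 1), ∏ i ∈ s, f i =
      ∑ s ∈ Sp m (k + 1), ∏ i ∈ s, f i + f (m + 1) * ∑ s ∈ Sp (m - 1) k, ∏ i ∈ s, f i := by
  have hnot : ∀ s ∈ Sp (m - 1) k, m + 1 ∉ s := by
    intro s hs h
    have := ((mem_Sp _ _ _).1 hs).1 _ h
    omega
  have key : Sp (m + 1) (k + 1) = Sp m (k + 1) ∪ (Sp (m - 1) k).image (insert (m + 1)) := by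
    ext s
    simp only [Finset.mem_union, Finset.mem_image]
    constructor
    · intro hs
      rw [mem_Sp] at hs
      obtain ⟨h1, h2, h3⟩ := hs
      by_cases h : m + 1 ∈ s
      · right
        refine ⟨s.erase (m + 1), ?_, Finset.insert_erase h⟩
        rw [mem_Sp]
        refine ⟨?_, ?_, ?_⟩
        · intro i hi
          rw [Finset.mem_erase] at hi
          have := h1 i hi.2
          have := h3 i hi.2 _ h (by omega)
          omega
        · rw [Finset.card_erase_of_mem h, h2]; rfl
        · intro i hi j hj
          exact h3 i (Finset.mem_of_mem_erase hi) j (Finset.mem_of_mem_erase hj)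
      · left
        rw [mem_Sp]
        refine ⟨?_, h2, h3⟩
        intro i hi
        have := h1 i hi
        have : i ≠ m + 1 := fun e => h (e ▸ hi)
        omega
    · rintro (hs | ⟨t, ht, rfl⟩)
      · rw [mem_Sp] at hs ⊢
        refine ⟨fun i hi => ?_, hs.2⟩
        have := hs.1 i hi
        omega
      · have hn := hnot t ht
        rw [mem_Sp] at ht ⊢
        obtain ⟨h1, h2, h3⟩ := ht
        refine ⟨?_, ?_, ?_⟩
        · intro i hi
          rw [Finset.mem_insert] at hi
          rcases hi with rfl | hi
          · omega
          · have := h1 i hi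
            omega
        · rw [Finset.card_insert_of_notMem hn, h2]
        · intro i hi j hj hij
          rw [Finset.mem_insert] at hi hj
          rcases hi with rfl | hi <;> rcases hj with rfl | hj
          · omega
          · have := h1 j hj
            omega
          · have := h1 i hi
            omega
          · exact h3 i hi j hj hij
  rw [key, Finset.sum_union, Finset.sum_image, Finset.mul_sum]
  · congr 1
    refine Finset.sum_congr rfl fun s hs => ?_
    rw [Finset.prod_insert (hnot s hs)]
  · intro s hs t ht h
    have h' := congrArg (fun u => Finset.erase u (m + 1)) h
    simpa [Finset.erase_insert (hnot s hs), Finset.erase_insert (hnot t ht)] using h'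
  · rw [Finset.disjoint_left]
    intro s hs hs'
    obtain ⟨t, ht, rfl⟩ := Finset.mem_image.1 hs'
    have := ((mem_Sp _ _ _).1 hs).1 (m + 1) (Finset.mem_insert_self _ _)
    omega

lemma Psi_eq_Sp (c : ℤ → ℝ) (b r : ℤ) : Psi c 1 b r = if 0 ≤ r then
    (∑ s ∈ Sp b r.toNat, ∏ i ∈ s, (c i * c (i + 1))⁻¹) * ∏ i ∈ Finset.Icc 1 (b + 1), c i
    else 0 := rfl

lemma prod_Icc_succ (c : ℤ → ℝ) (b : ℤ) (hb : 0 ≤ b) :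
    ∏ i ∈ Finset.Icc 1 (b + 1), c i = c (b + 1) * ∏ i ∈ Finset.Icc 1 b, c i := by
  have : Finset.Icc (1 : ℤ) (b + 1) = insert (b + 1) (Finset.Icc 1 b) := by
    ext i; simp only [Finset.mem_insert, Finset.mem_Icc]; omega
  rw [this, Finset.prod_insert (by simp)]

lemma Psi_rec (c : ℤ → ℝ) (hc : ∀ i, c i ≠ 0) (m : ℤ) (hm : 0 ≤ m) (r : ℤ) :
    Psi c 1 (m + 1) r = c (m + 2) * Psi c 1 m r + Psi c 1 (m - 1) (r - 1) := by
  simp only [Psi_eq_Sp]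
  rcases lt_trichotomy r 0 with h | h | h
  · rw [if_neg (by omega), if_neg (by omega), if_neg (by omega)]; ring
  · subst h
    rw [if_pos le_rfl, if_pos le_rfl, if_neg (by omega), prod_Icc_succ c (m + 1) (by omega)]
    simp only [Int.toNat_zero, Sp_zero]
    simp only [Finset.sum_singleton, Finset.prod_empty]
    rw [show m + 1 + 1 = m + 2 by ring]; ring
  · obtain ⟨k, rfl⟩ : ∃ k : ℕ, r = k + 1 := ⟨(r - 1).toNat, by omega⟩
    rw [if_pos (by omega), if_pos (by omega), if_pos (by omega)]
    have e1 : ((k : ℤ) + 1).toNat = k + 1 := by omega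
    have e2 : ((k : ℤ) + 1 - 1).toNat = k := by omega
    rw [e1, e2, Sp_succ m hm, prod_Icc_succ c (m + 1) (by omega), prod_Icc_succ c m hm]
    rw [show m + 1 + 1 = m + 2 by ring, show m - 1 + 1 = m by ring]
    have h1 := hc (m + 1)
    have h2 := hc (m + 2)
    field_simp

lemma Psi_eq_KK (c : ℤ → ℝ) (hc : ∀ i, c i ≠ 0) (m : ℕ) : ∀ r : ℤ,
    Psi c 1 ((m : ℤ) - 1) r = KK c m r := by
  have base : ∀ b : ℤ, b ≤ 0 → ∀ r : ℤ, Psi c 1 b r =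
      if r = 0 then ∏ i ∈ Finset.Icc 1 (b + 1), c i else 0 := by
    intro b hb r
    rw [Psi_eq_Sp]
    rcases lt_trichotomy r 0 with h | h | h
    · rw [if_neg (by omega), if_neg (by omega)]
    · subst h
      simp [Sp_zero]
    · rw [if_pos (by omega), if_neg (by omega), Sp_empty b hb _ (by omega)]; simp
  induction m using Nat.strong_induction_on with
  | _ m ih =>
    match m, ih with
    | 0, _ => intro r; rw [base _ (by simp)]; simp [KK]
    | 1, _ => intro r; rw [base _ (by simp)]; simp [KK]
    | (m + 2), ih =>
      intro r
      have := Psi_rec c hc m (by omega) r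
      rw [show ((m + 2 : ℕ) : ℤ) - 1 = m + 1 by push_cast; ring, this,
        show KK c (m + 2) r = c ((m : ℤ) + 2) * KK c (m + 1) r + KK c m (r - 1) from rfl,
        ← ih (m + 1) (by omega), ← ih m (by omega)]
      push_cast
      simp

lemma pdC_Psi (c : ℤ → ℝ) (hc : ∀ i, c i ≠ 0) (m : ℕ) (r i : ℤ) :
    pdC (fun c => Psi c 1 ((m : ℤ) - 1) r) i c = GG c m r i := by
  unfold pdC
  refine HasDerivAt.deriv ((KK_deriv c i m r).congr_of_eventuallyEq ?_)
  filter_upwards [isOpen_ne.mem_nhds (hc i)] with t ht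
  apply Psi_eq_KK
  intro j
  by_cases h : j = i
  · subst h; simpa using ht
  · simpa [Function.update_apply, h] using hc j


/-- The symmetric relation `{Ψ^{1,p}_r, Ψ^{1,p−1}_s}_c + {Ψ^{1,p−1}_r, Ψ^{1,p}_s}_c = 0`
for all `0 ≤ r, s ≤ ⌊(p+1)/2⌋` (variables `c_1, …, c_{2n}`, `p ≤ 2n − 1`). -/
theorem psi_bracket_symmetric_zero (n : ℕ) (p : ℤ) (hp1 : 1 ≤ p) (hp : p ≤ 2 * n - 1)
    (c : ℤ → ℝ) (hc : ∀ i, c i ≠ 0) (r s : ℤ)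
    (hr0 : 0 ≤ r) (hr : r ≤ (p + 1) / 2) (hs0 : 0 ≤ s) (hs : s ≤ (p + 1) / 2) :
    cBracket n (fun c => Psi c 1 p r) (fun c => Psi c 1 (p - 1) s) c +
      cBracket n (fun c => Psi c 1 (p - 1) r) (fun c => Psi c 1 p s) c = 0 := by
  obtain ⟨m, rfl⟩ : ∃ m : ℕ, p = m := ⟨p.toNat, by omega⟩
  have h := (main_ind c (2 * n - 1) m hp).2.2.1 r s
  have e : (m : ℤ) = ((m + 1 : ℕ) : ℤ) - 1 := by push_cast; ring
  have h1 : ∀ r i, pdC (fun c => Psi c 1 (m : ℤ) r) i c = GG c (m + 1) r i := by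
    intro r i
    rw [← pdC_Psi c hc (m + 1) r i, ← e]
  simp only [cBracket, h1, pdC_Psi c hc m]
  exact h
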